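/- Let R be a commutative noetherian ring and C a semidualizing R-module. An R-module M is C-flat if and only if M is G_C-flat and M has finite C-flat projective dimension (i.e., there exist n and an exact sequence 0 → X_n → ⋯ → X_0 → M → 0 with each X_i C-flat). -/

import Mathlib

open CategoryTheory TensorProduct

universe u

section
variable (R : Type u) [CommRing R]

def extZero (M N : ModuleCat.{u} R) : Prop :=
  ∀ i : ℕ, 1 ≤ i → Subsingleton (((Ext R (ModuleCat.{u} R) i).obj (Opposite.op M)).obj N)

def torZero (M N : ModuleCat.{u} R) : Prop :=
  ∀ i : ℕ, 1 ≤ i → Subsingleton (((Tor (ModuleCat.{u} R) i).obj M).obj N)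

def IsSemidualizing (C : ModuleCat.{u} R) : Prop :=
  Module.Finite R C ∧ Function.Bijective (LinearMap.lsmul R C) ∧ extZero R C C

/-- A module is `C`-flat if it is isomorphic to `F ⊗[R] C` with `F` flat. -/
def IsCFlat (C M : ModuleCat.{u} R) : Prop :=
  ∃ F : ModuleCat.{u} R, Module.Flat R F ∧ Nonempty (M ≃ₗ[R] (F ⊗[R] C))

def IsCInjective (C M : ModuleCat.{u} R) : Prop :=
  ∃ I : ModuleCat.{u} R, Module.Injective R I ∧ Nonempty (M ≃ₗ[R] (↥C →ₗ[R] ↥I))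

/-- cotorsion: `Ext^{≥1}(F, N) = 0` for all flat `F`. -/
def IsCotorsion (N : ModuleCat.{u} R) : Prop :=
  ∀ F : ModuleCat.{u} R, Module.Flat R F → extZero R F N

/-- `C`-cotorsion: `Ext^{≥1}(F ⊗ C, N) = 0` for all flat `F`. -/
def IsCCotorsion (C N : ModuleCat.{u} R) : Prop :=
  ∀ F : ModuleCat.{u} R, Module.Flat R F →
    extZero R (ModuleCat.of R (↥F ⊗[R] ↥C)) N

/-- `C`-flat `C`-cotorsion: isomorphic to `F ⊗ C` with `F` flat and cotorsion. -/
def IsCFlatCotorsion (C M : ModuleCat.{u} R) : Prop :=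
  ∃ F : ModuleCat.{u} R, Module.Flat R F ∧ IsCotorsion R F ∧
    Nonempty (M ≃ₗ[R] (F ⊗[R] C))

/-- The natural evaluation map `C ⊗ Hom(C,M) → M`. -/
noncomputable def evalMap (C M : ModuleCat.{u} R) :
    (↥C ⊗[R] (↥C →ₗ[R] ↥M)) →ₗ[R] ↥M :=
  TensorProduct.lift (LinearMap.id (R := R) (M := ↥C →ₗ[R] ↥M)).flip

/-- The Bass class `B_C(R)`. -/
noncomputable def InBassClass (C M : ModuleCat.{u} R) : Prop :=
  extZero R C M ∧
  torZero R C (ModuleCat.of R (↥C →ₗ[R] ↥M)) ∧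
  Function.Bijective (evalMap R C M)

/-- A `ℤ`-indexed complex of `R`-modules: `d i : X (i+1) → X i`. -/
structure ZComplex where
  X : ℤ → ModuleCat.{u} R
  d : ∀ i : ℤ, ↥(X (i + 1)) →ₗ[R] ↥(X i)
  d_comp_d : ∀ i : ℤ, (d i).comp (d (i + 1)) = 0

namespace ZComplex

variable {R} (Z : ZComplex R)

/-- Exactness of the complex. -/
def IsExact : Prop := ∀ i : ℤ, Function.Exact (Z.d (i + 1)) (Z.d i)

/-- Exactness of `Z ⊗[R] J`. -/
def TensorExact (J : ModuleCat.{u} R) : Prop :=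
  ∀ i : ℤ, Function.Exact (LinearMap.rTensor (↥J) (Z.d (i + 1)))
    (LinearMap.rTensor (↥J) (Z.d i))

/-- Exactness of `Hom_R(V, Z)`. -/
def HomFromExact (V : ModuleCat.{u} R) : Prop :=
  ∀ i : ℤ, Function.Exact
    (fun f : ↥V →ₗ[R] ↥(Z.X (i + 1 + 1)) => (Z.d (i + 1)).comp f)
    (fun f : ↥V →ₗ[R] ↥(Z.X (i + 1)) => (Z.d i).comp f)

/-- Exactness of `Hom_R(Z, V)`. -/
def HomToExact (V : ModuleCat.{u} R) : Prop :=
  ∀ i : ℤ, Function.Exact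
    (fun g : ↥(Z.X i) →ₗ[R] ↥V => g.comp (Z.d i))
    (fun g : ↥(Z.X (i + 1)) →ₗ[R] ↥V => g.comp (Z.d (i + 1)))

/-- `M ≅ Coker(∂₁)`. -/
def IsCokerOfD1 (M : ModuleCat.{u} R) : Prop :=
  Nonempty (↥M ≃ₗ[R] (↥(Z.X 0) ⧸ LinearMap.range (Z.d 0)))

end ZComplex

end

section
variable (R : Type u) [CommRing R]

/-- A complete `FF_C`-resolution witnessing that `M` is `G_C`-flat. -/
def IsGCFlat (C M : ModuleCat.{u} R) : Prop :=
  ∃ Z : ZComplex R, Z.IsExact ∧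
    (∀ i : ℤ, 0 ≤ i → Module.Flat R (Z.X i)) ∧
    (∀ i : ℤ, i < 0 → IsCFlat R C (Z.X i)) ∧
    (∀ J : ModuleCat.{u} R, IsCInjective R C J → Z.TensorExact J) ∧
    Z.IsCokerOfD1 M

def IsCProjective (C M : ModuleCat.{u} R) : Prop :=
  ∃ P : ModuleCat.{u} R, Module.Projective R P ∧ Nonempty (M ≃ₗ[R] (P ⊗[R] C))

/-- A complete `PP_C`-resolution witnessing that `M` is `G_C`-projective. -/
def IsGCProjective (C M : ModuleCat.{u} R) : Prop :=
  ∃ Z : ZComplex R, Z.IsExact ∧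
    (∀ i : ℤ, 0 ≤ i → Module.Projective R (Z.X i)) ∧
    (∀ i : ℤ, i < 0 → IsCProjective R C (Z.X i)) ∧
    (∀ Q : ModuleCat.{u} R, IsCProjective R C Q → Z.HomToExact Q) ∧
    Z.IsCokerOfD1 M

/-- `G(𝒳)` for a class `𝒳` of modules. -/
def GClass (𝒳 : ModuleCat.{u} R → Prop) (M : ModuleCat.{u} R) : Prop :=
  ∃ Z : ZComplex R, Z.IsExact ∧
    (∀ i : ℤ, 𝒳 (Z.X i)) ∧
    (∀ V : ModuleCat.{u} R, 𝒳 V → Z.HomFromExact V) ∧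
    (∀ V : ModuleCat.{u} R, 𝒳 V → Z.HomToExact V) ∧
    Z.IsCokerOfD1 M

/-- Iterates `G^n(𝒳)`, with `G^0(𝒳) = 𝒳`. -/
def GIter : ℕ → (ModuleCat.{u} R → Prop) → (ModuleCat.{u} R → Prop)
  | 0, 𝒳 => 𝒳
  | n + 1, 𝒳 => GClass R (GIter n 𝒳)

/-- `H_C(𝒳)`: modules with a `P_C F_C^cot`-complete `𝒳`-resolution. -/
def HClass (C : ModuleCat.{u} R) (𝒳 : ModuleCat.{u} R → Prop) (M : ModuleCat.{u} R) : Prop :=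
  ∃ Z : ZComplex R, Z.IsExact ∧
    (∀ i : ℤ, 𝒳 (Z.X i)) ∧
    (∀ P : ModuleCat.{u} R, Module.Projective R P →
      Z.HomFromExact (ModuleCat.of R (↥P ⊗[R] ↥C))) ∧
    (∀ N : ModuleCat.{u} R, IsCFlatCotorsion R C N → Z.HomToExact N) ∧
    Z.IsCokerOfD1 M

/-- Iterates `H_C^n(𝒳)`, with `H_C^0(𝒳) = 𝒳`. -/
def HIter (C : ModuleCat.{u} R) : ℕ → (ModuleCat.{u} R → Prop) → (ModuleCat.{u} R → Prop)
  | 0, 𝒳 => 𝒳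
  | n + 1, 𝒳 => HClass R C (HIter C n 𝒳)

/-- `M` admits a resolution `0 → X_n → ⋯ → X_0 → M → 0` with each `X_i` in `𝒳`. -/
def HasResOfLength (𝒳 : ModuleCat.{u} R → Prop) (n : ℕ) (M : ModuleCat.{u} R) : Prop :=
  ∃ (P : ℕ → ModuleCat.{u} R) (d : ∀ i : ℕ, ↥(P (i + 1)) →ₗ[R] ↥(P i))
    (ε : ↥(P 0) →ₗ[R] ↥M),
      Function.Surjective ε ∧ Function.Exact (d 0) ε ∧
      (∀ i : ℕ, Function.Exact (d (i + 1)) (d i)) ∧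
      (∀ i : ℕ, i ≤ n → 𝒳 (P i)) ∧
      (∀ i : ℕ, n < i → Subsingleton (P i))

/-- `M` admits a coresolution `0 → M → Y_0 → ⋯ → Y_n → 0` with each `Y_i` in `𝒳`. -/
def HasCoresOfLength (𝒳 : ModuleCat.{u} R → Prop) (n : ℕ) (M : ModuleCat.{u} R) : Prop :=
  ∃ (P : ℕ → ModuleCat.{u} R) (d : ∀ i : ℕ, ↥(P i) →ₗ[R] ↥(P (i + 1)))
    (η : ↥M →ₗ[R] ↥(P 0)),
      Function.Injective η ∧ Function.Exact η (d 0) ∧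
      (∀ i : ℕ, Function.Exact (d i) (d (i + 1))) ∧
      (∀ i : ℕ, i ≤ n → 𝒳 (P i)) ∧
      (∀ i : ℕ, n < i → Subsingleton (P i))

/-- `C` is a dualizing module: semidualizing of finite injective dimension. -/
def IsDualizing (C : ModuleCat.{u} R) : Prop :=
  IsSemidualizing R C ∧
  ∃ n : ℕ, HasCoresOfLength R (fun I => Module.Injective R ↥I) n C

end

section TensorLemmas

variable {R : Type u} [CommRing R]

/-- A diagram chase in the tensor product of two short exact sequences. -/
lemma rTensor_injective_of_lTensor_injective {K Q P A B D : Type*}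
    [AddCommGroup K] [AddCommGroup Q] [AddCommGroup P]
    [AddCommGroup A] [AddCommGroup B] [AddCommGroup D]
    [Module R K] [Module R Q] [Module R P] [Module R A] [Module R B] [Module R D]
    {f : K →ₗ[R] Q} {g : Q →ₗ[R] P} {i : A →ₗ[R] B} {p : B →ₗ[R] D}
    (hfg : Function.Exact f g) (hg : Function.Surjective g)
    (hip : Function.Exact i p) (hp : Function.Surjective p)
    (h₁ : Function.Injective (i.lTensor P)) (h₂ : Function.Injective (f.rTensor B)) :
    Function.Injective (f.rTensor D) := by
  rw [injective_iff_map_eq_zero]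
  intro x hx
  obtain ⟨y, rfl⟩ := LinearMap.lTensor_surjective K hp x
  have comm_fp : ∀ y, f.rTensor D (p.lTensor K y) = p.lTensor Q (f.rTensor B y) := fun y => by
    rw [← LinearMap.comp_apply, ← LinearMap.comp_apply, LinearMap.rTensor_comp_lTensor,
      LinearMap.lTensor_comp_rTensor]
  have comm_fi : ∀ y, f.rTensor B (i.lTensor K y) = i.lTensor Q (f.rTensor A y) := fun y => by
    rw [← LinearMap.comp_apply, ← LinearMap.comp_apply, LinearMap.rTensor_comp_lTensor,
      LinearMap.lTensor_comp_rTensor]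
  have comm_gi : ∀ y, g.rTensor B (i.lTensor Q y) = i.lTensor P (g.rTensor A y) := fun y => by
    rw [← LinearMap.comp_apply, ← LinearMap.comp_apply, LinearMap.rTensor_comp_lTensor,
      LinearMap.lTensor_comp_rTensor]
  rw [comm_fp] at hx
  obtain ⟨z, hz⟩ := (lTensor_exact Q hip hp _).1 hx
  have hgz : g.rTensor A z = 0 := by
    apply h₁
    rw [map_zero, ← comm_gi, hz]
    exact (rTensor_exact B hfg hg).apply_apply_eq_zero y
  obtain ⟨w, rfl⟩ := (rTensor_exact A hfg hg _).1 hgz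
  have hw : i.lTensor K w = y := h₂ (by rw [comm_fi, hz])
  rw [← hw]
  exact (lTensor_exact K hip hp).apply_apply_eq_zero w

/-- A short exact sequence with flat cokernel is pure. -/
lemma rTensor_injective_of_flat {K Q P : Type u}
    [AddCommGroup K] [AddCommGroup Q] [AddCommGroup P]
    [Module R K] [Module R Q] [Module R P] [Module.Flat R P]
    {f : K →ₗ[R] Q} {g : Q →ₗ[R] P} (hf : Function.Injective f)
    (hfg : Function.Exact f g) (hg : Function.Surjective g)
    (D : Type u) [AddCommGroup D] [Module R D] : Function.Injective (f.rTensor D) := by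
  let p : (D →₀ R) →ₗ[R] D := Finsupp.linearCombination R id
  have hp : Function.Surjective p := Finsupp.linearCombination_id_surjective R D
  exact rTensor_injective_of_lTensor_injective hfg hg p.exact_subtype_ker_map hp
    (Module.Flat.lTensor_preserves_injective_linearMap _ (Submodule.injective_subtype _))
    (Module.Flat.rTensor_preserves_injective_linearMap _ hf)

/-- The kernel of a surjection between flat modules is flat. -/
lemma flat_of_exact_of_flat {K Q P : Type u}
    [AddCommGroup K] [AddCommGroup Q] [AddCommGroup P]
    [Module R K] [Module R Q] [Module R P] [Module.Flat R P] [Module.Flat R Q]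
    {f : K →ₗ[R] Q} {g : Q →ₗ[R] P} (hf : Function.Injective f)
    (hfg : Function.Exact f g) (hg : Function.Surjective g) : Module.Flat R K := by
  rw [Module.Flat.iff_lTensor_preserves_injective_linearMap]
  intro A B _ _ _ _ i hi
  have h : Function.Injective (i.lTensor Q ∘ₗ f.rTensor A) :=
    (Module.Flat.lTensor_preserves_injective_linearMap i hi).comp
      (rTensor_injective_of_flat hf hfg hg A)
  rw [LinearMap.lTensor_comp_rTensor, ← LinearMap.rTensor_comp_lTensor, LinearMap.coe_comp] at h
  exact h.of_comp

/-- The cokernel of a universally injective map into a flat module is flat. -/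
lemma flat_of_rTensor_injective {K Q P : Type u}
    [AddCommGroup K] [AddCommGroup Q] [AddCommGroup P]
    [Module R K] [Module R Q] [Module R P] [Module.Flat R Q]
    {f : K →ₗ[R] Q} {g : Q →ₗ[R] P} (hfg : Function.Exact f g) (hg : Function.Surjective g)
    (hf : ∀ (D : Type u) [AddCommGroup D] [Module R D], Function.Injective (f.rTensor D)) :
    Module.Flat R P := by
  rw [Module.Flat.iff_rTensor_preserves_injective_linearMap]
  intro A B _ _ _ _ i hi
  refine rTensor_injective_of_lTensor_injective (g := (LinearMap.range i).mkQ) ?_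
    (Submodule.mkQ_surjective _) hfg hg ?_
    (Module.Flat.rTensor_preserves_injective_linearMap i hi)
  · exact i.exact_map_mkQ_range
  · exact (LinearMap.lTensor_inj_iff_rTensor_inj _ _).2 (hf _)

variable {C : Type u} [AddCommGroup C] [Module R C]

/-- The map `N ⊗ Hom(C, I) → Hom(Hom(N, C), I)` sending `n ⊗ h` to `φ ↦ h (φ n)`. -/
noncomputable def tensorHomEval (R C I N : Type u) [CommRing R] [AddCommGroup C] [Module R C]
    [AddCommGroup I] [Module R I] [AddCommGroup N] [Module R N] :
    N ⊗[R] (C →ₗ[R] I) →ₗ[R] ((N →ₗ[R] C) →ₗ[R] I) :=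
  TensorProduct.lift
    ((LinearMap.llcomp R (N →ₗ[R] C) C I).flip ∘ₗ (LinearMap.id (M := N →ₗ[R] C)).flip)

@[simp]
lemma tensorHomEval_tmul_apply {I N : Type u} [AddCommGroup I] [Module R I] [AddCommGroup N]
    [Module R N] (n : N) (h : C →ₗ[R] I) (φ : N →ₗ[R] C) :
    tensorHomEval R C I N (n ⊗ₜ h) φ = h (φ n) := rfl

lemma tensorHomEval_naturality {I N N' : Type u} [AddCommGroup I] [Module R I] [AddCommGroup N]
    [Module R N] [AddCommGroup N'] [Module R N'] (f : N →ₗ[R] N') :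
    tensorHomEval R C I N' ∘ₗ f.rTensor (C →ₗ[R] I) =
      (f.lcomp R C).lcomp R I ∘ₗ tensorHomEval R C I N := by
  ext
  simp

lemma lcomp_exact_of_exact {A B D : Type u} [AddCommGroup A] [AddCommGroup B] [AddCommGroup D]
    [Module R A] [Module R B] [Module R D] {f : A →ₗ[R] B} {g : B →ₗ[R] D}
    (hfg : Function.Exact f g) (I : Type u) [AddCommGroup I] [Module R I] [Module.Injective R I] :
    Function.Exact (g.lcomp R I) (f.lcomp R I) := by
  intro h
  refine ⟨fun hh => ?_, ?_⟩
  · have hex : Function.Exact f g.rangeRestrict := fun b => by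
      rw [← hfg b, ← Submodule.coe_eq_zero]
      rfl
    obtain ⟨k, hk⟩ := (LinearMap.exact_lcomp_of_exact_of_surjective I hex
      g.surjective_rangeRestrict h).1 hh
    obtain ⟨l, hl⟩ := Module.Injective.extension_property R I _ _ (LinearMap.range g).subtype
      (Submodule.injective_subtype _) k
    refine ⟨l, ?_⟩
    rw [← hk, ← hl]
    rfl
  · rintro ⟨k, rfl⟩
    ext a
    simp [hfg.apply_apply_eq_zero]

/-- The map `C → Hom(Rⁿ, C)` sending `c` to `v ↦ v j • c`. -/
noncomputable def projSMul (R C : Type u) [CommRing R] [AddCommGroup C] [Module R C] {n : ℕ}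
    (j : Fin n) : C →ₗ[R] ((Fin n → R) →ₗ[R] C) :=
  (LinearMap.lsmul R C).flip.compl₂ (LinearMap.proj j)

@[simp]
lemma projSMul_apply {n : ℕ} (j : Fin n) (c : C) (v : Fin n → R) :
    projSMul R C j c v = v j • c := rfl

lemma sum_projSMul_apply_single {n : ℕ} (f : (Fin n → R) →ₗ[R] C) :
    ∑ j, projSMul R C j (f (Pi.single j 1)) = f := by
  ext v
  simp [Pi.single_apply]

lemma tensorHomEval_bijective_pi {I : Type u} [AddCommGroup I] [Module R I] (n : ℕ) :
    Function.Bijective (tensorHomEval R C I (Fin n → R)) := by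
  let inv : (((Fin n → R) →ₗ[R] C) →ₗ[R] I) → (Fin n → R) ⊗[R] (C →ₗ[R] I) :=
    fun Θ => ∑ j, Pi.single j (1 : R) ⊗ₜ (Θ ∘ₗ projSMul R C j)
  refine Function.bijective_iff_has_inverse.2 ⟨inv, fun x => ?_, fun Θ => ?_⟩
  · induction x with
    | zero => simp [inv]
    | add x y hx hy =>
      simp only [inv, map_add, LinearMap.add_comp, TensorProduct.tmul_add,
        Finset.sum_add_distrib] at hx hy ⊢
      rw [hx, hy]
    | tmul v h =>
      have : ∀ j, tensorHomEval R C I (Fin n → R) (v ⊗ₜ h) ∘ₗ projSMul R C j = v j • h := by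
        intro j
        ext c
        simp
      simp only [inv, this]
      conv_rhs => rw [pi_eq_sum_univ' v, TensorProduct.sum_tmul]
      simp [TensorProduct.smul_tmul]
  · ext f
    simp only [inv, map_sum, LinearMap.sum_apply, tensorHomEval_tmul_apply, LinearMap.comp_apply]
    rw [← map_sum, sum_projSMul_apply_single]

lemma tensorHomEval_bijective {I N : Type u} [AddCommGroup I] [Module R I] [Module.Injective R I]
    [AddCommGroup N] [Module R N] [Module.FinitePresentation R N] :
    Function.Bijective (tensorHomEval R C I N) := by
  obtain ⟨n, m, f, g, hf, hfg⟩ := Module.FinitePresentation.exists_fin' R N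
  have h1 : Function.Surjective ((f.lcomp R C).lcomp R I) := fun k =>
    Module.Injective.extension_property R I _ _ (f.lcomp R C)
      (LinearMap.lcomp_injective_of_surjective f hf) k
  exact LinearMap.bijective_of_surjective_of_bijective_of_right_exact
    (g.rTensor (C →ₗ[R] I)) (f.rTensor (C →ₗ[R] I))
    ((g.lcomp R C).lcomp R I) ((f.lcomp R C).lcomp R I)
    (tensorHomEval R C I _) (tensorHomEval R C I _) (tensorHomEval R C I N)
    (tensorHomEval_naturality g).symm (tensorHomEval_naturality f).symm
    (rTensor_exact _ hfg hf) (lcomp_exact_of_exact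
      (LinearMap.exact_lcomp_of_exact_of_surjective C hfg hf) I)
    (tensorHomEval_bijective_pi m).2 (tensorHomEval_bijective_pi n)
    (LinearMap.rTensor_surjective _ hf) h1

lemma lTensorHomToHomLTensor_bijective_pi (F : Type u) [AddCommGroup F] [Module R F] (n : ℕ) :
    Function.Bijective
      (TensorProduct.lTensorHomToHomLTensor (RingHom.id R) (Fin n → R) F C) := by
  let inv : ((Fin n → R) →ₗ[R] F ⊗[R] C) → F ⊗[R] ((Fin n → R) →ₗ[R] C) :=
    fun θ => ∑ j, (projSMul R C j).lTensor F (θ (Pi.single j 1))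
  refine Function.bijective_iff_has_inverse.2 ⟨inv, fun x => ?_, fun θ => ?_⟩
  · induction x with
    | zero => simp [inv]
    | add x y hx hy =>
      simp only [inv, map_add, LinearMap.add_apply, Finset.sum_add_distrib] at hx hy ⊢
      rw [hx, hy]
    | tmul x g =>
      simp only [inv, TensorProduct.lTensorHomToHomLTensor_apply, LinearMap.lTensor_tmul]
      rw [← TensorProduct.tmul_sum, sum_projSMul_apply_single]
  · have key : ∀ (j : Fin n) (v : Fin n → R) (y : F ⊗[R] C),
        TensorProduct.lTensorHomToHomLTensor (RingHom.id R) (Fin n → R) F C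
          ((projSMul R C j).lTensor F y) v = v j • y := by
      intro j v y
      induction y with
      | zero => simp
      | add x y hx hy => simp only [map_add, LinearMap.add_apply, hx, hy, smul_add]
      | tmul x c => simp
    refine LinearMap.ext fun v => ?_
    simp only [inv, map_sum, LinearMap.sum_apply, key]
    conv_rhs => rw [pi_eq_sum_univ' v]
    simp [map_sum]

lemma lTensorHomToHomLTensor_bijective (F N : Type u) [AddCommGroup F] [Module R F]
    [Module.Flat R F] [AddCommGroup N] [Module R N] [Module.FinitePresentation R N] :
    Function.Bijective (TensorProduct.lTensorHomToHomLTensor (RingHom.id R) N F C) := by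
  obtain ⟨n, m, f, g, hf, hfg⟩ := Module.FinitePresentation.exists_fin' R N
  refine LinearMap.bijective_of_bijective_of_injective_of_left_exact
    ((f.lcomp R C).lTensor F) ((g.lcomp R C).lTensor F)
    (f.lcomp R (F ⊗[R] C)) (g.lcomp R (F ⊗[R] C))
    (TensorProduct.lTensorHomToHomLTensor (RingHom.id R) N F C)
    (TensorProduct.lTensorHomToHomLTensor (RingHom.id R) _ F C)
    (TensorProduct.lTensorHomToHomLTensor (RingHom.id R) _ F C) ?_ ?_
    (Module.Flat.lTensor_exact F (LinearMap.exact_lcomp_of_exact_of_surjective C hfg hf))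
    (LinearMap.exact_lcomp_of_exact_of_surjective _ hfg hf)
    (lTensorHomToHomLTensor_bijective_pi F n) (lTensorHomToHomLTensor_bijective_pi F m).1
    (Module.Flat.lTensor_preserves_injective_linearMap _
      (LinearMap.lcomp_injective_of_surjective f hf))
    (LinearMap.lcomp_injective_of_surjective f hf)
  · ext; simp
  · ext; simp

/-- If `R → Hom(C, C)` is bijective and `F` is flat, then `F ≅ Hom(C, F ⊗ C)`. -/
lemma tensorProductMk_bijective [Module.FinitePresentation R C]
    (hC : Function.Bijective (LinearMap.lsmul R C)) (F : Type u) [AddCommGroup F] [Module R F]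
    [Module.Flat R F] : Function.Bijective (TensorProduct.mk R F C) := by
  let e : R ≃ₗ[R] (C →ₗ[R] C) := LinearEquiv.ofBijective (LinearMap.lsmul R C) hC
  have h : TensorProduct.mk R F C =
      TensorProduct.lTensorHomToHomLTensor (RingHom.id R) C F C ∘ₗ
        (e.lTensor F).toLinearMap ∘ₗ (TensorProduct.rid R F).symm.toLinearMap := by
    ext
    simp [e]
  rw [h]
  exact (lTensorHomToHomLTensor_bijective F C).comp
    ((e.lTensor F).bijective.comp (TensorProduct.rid R F).symm.bijective)

/-- If `R → Hom(C, C)` is bijective and `F₀` is flat, then every map `F₁ ⊗ C → F₀ ⊗ C` is induced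
by a map `F₁ → F₀`. -/
lemma exists_rTensor_eq [Module.FinitePresentation R C]
    (hC : Function.Bijective (LinearMap.lsmul R C)) {F₁ F₀ : Type u} [AddCommGroup F₁]
    [Module R F₁] [AddCommGroup F₀] [Module R F₀] [Module.Flat R F₀]
    (f : F₁ ⊗[R] C →ₗ[R] F₀ ⊗[R] C) : ∃ φ : F₁ →ₗ[R] F₀, φ.rTensor C = f := by
  let e : F₀ ≃ₗ[R] (C →ₗ[R] F₀ ⊗[R] C) :=
    LinearEquiv.ofBijective (TensorProduct.mk R F₀ C) (tensorProductMk_bijective hC F₀)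
  refine ⟨e.symm.toLinearMap ∘ₗ TensorProduct.curry f, TensorProduct.ext ?_⟩
  ext x c
  exact LinearMap.congr_fun (e.apply_symm_apply (TensorProduct.curry f x)) c

/-- Injective modules satisfy `C ⊗ Hom(C, I) ≅ I` when `R → Hom(C, C)` is bijective. -/
lemma nonempty_tensorHom_equiv [Module.FinitePresentation R C]
    (hC : Function.Bijective (LinearMap.lsmul R C)) (I : Type u) [AddCommGroup I] [Module R I]
    [Module.Injective R I] : Nonempty (C ⊗[R] (C →ₗ[R] I) ≃ₗ[R] I) :=
  ⟨LinearEquiv.ofBijective _ (tensorHomEval_bijective (C := C) (N := C)) ≪≫ₗ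
    (LinearEquiv.ofBijective _ hC).symm.congrLeft I R ≪≫ₗ LinearMap.ringLmapEquivSelf R R I⟩

lemma rTensor_tensor_injective_iff {A B X Y : Type*} [AddCommGroup A] [AddCommGroup B]
    [AddCommGroup X] [AddCommGroup Y] [Module R A] [Module R B] [Module R X] [Module R Y]
    (f : A →ₗ[R] B) :
    Function.Injective ((f.rTensor X).rTensor Y) ↔ Function.Injective (f.rTensor (X ⊗[R] Y)) := by
  rw [LinearMap.rTensor_tensor]
  simp

lemma rTensor_injective_congr {A B X Y : Type*} [AddCommGroup A] [AddCommGroup B]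
    [AddCommGroup X] [AddCommGroup Y] [Module R A] [Module R B] [Module R X] [Module R Y]
    (f : A →ₗ[R] B) (e : X ≃ₗ[R] Y) (h : Function.Injective (f.rTensor X)) :
    Function.Injective (f.rTensor Y) := by
  have h' : f.rTensor Y = (e.lTensor B).toLinearMap ∘ₗ f.rTensor X ∘ₗ
      (e.lTensor A).symm.toLinearMap := by
    ext
    simp
  rw [h']
  exact (e.lTensor B).injective.comp (h.comp (e.lTensor A).symm.injective)

/-- Every module embeds into an injective module. -/
lemma exists_injective_embedding (D : Type u) [AddCommGroup D] [Module R D] :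
    ∃ (I : ModuleCat.{u} R) (i : D →ₗ[R] I), Module.Injective R I ∧ Function.Injective i :=
  ⟨Injective.under (ModuleCat.of R D), (Injective.ι (ModuleCat.of R D)).hom,
    (Module.injective_iff_injective_object R _).2
      (inferInstanceAs (Injective (Injective.under (ModuleCat.of R D)))),
    (ModuleCat.mono_iff_injective _).1 inferInstance⟩

/-- A cokernel of `C`-flat modules whose presentation stays injective after tensoring with
`C`-injective modules is `C`-flat. -/
lemma exists_flat_of_rTensor_injective [Module.FinitePresentation R C]
    (hC : Function.Bijective (LinearMap.lsmul R C)) {F₁ F₀ M : Type u} [AddCommGroup F₁]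
    [Module R F₁] [AddCommGroup F₀] [Module R F₀] [Module.Flat R F₁] [Module.Flat R F₀]
    [AddCommGroup M] [Module R M]
    {f : F₁ ⊗[R] C →ₗ[R] F₀ ⊗[R] C} {g : F₀ ⊗[R] C →ₗ[R] M}
    (hfg : Function.Exact f g) (hg : Function.Surjective g)
    (hf : ∀ (I : Type u) [AddCommGroup I] [Module R I] [Module.Injective R I],
      Function.Injective (f.rTensor (C →ₗ[R] I))) :
    ∃ F : ModuleCat.{u} R, Module.Flat R F ∧ Nonempty (M ≃ₗ[R] F ⊗[R] C) := by
  obtain ⟨φ, rfl⟩ := exists_rTensor_eq hC f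
  have hφ : ∀ (D : Type u) [AddCommGroup D] [Module R D], Function.Injective (φ.rTensor D) := by
    intro D _ _
    obtain ⟨I, i, hI, hi⟩ := exists_injective_embedding (R := R) D
    obtain ⟨e⟩ := nonempty_tensorHom_equiv hC I
    have h1 := rTensor_injective_congr φ e ((rTensor_tensor_injective_iff φ).1 (hf I))
    have h2 := h1.comp (Module.Flat.lTensor_preserves_injective_linearMap (M := F₁) i hi)
    rw [← LinearMap.coe_comp, LinearMap.rTensor_comp_lTensor, ← LinearMap.lTensor_comp_rTensor,
      LinearMap.coe_comp] at h2
    exact h2.of_comp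
  have hq := φ.exact_map_mkQ_range
  have hs := (LinearMap.range φ).mkQ_surjective
  refine ⟨ModuleCat.of R (F₀ ⧸ LinearMap.range φ), flat_of_rTensor_injective hq hs hφ, ⟨?_⟩⟩
  exact (hfg.linearEquivOfSurjective hg).symm ≪≫ₗ
    (rTensor_exact C hq hs).linearEquivOfSurjective (LinearMap.rTensor_surjective C hs)

end TensorLemmas

section ExtVanishing

variable {R : Type u} [CommRing R]

/-- `Ext^{≥ 1}(M, V) = 0`. -/
def ExtVanish (M V : ModuleCat.{u} R) : Prop :=
  ∀ n : ℕ, Subsingleton (Abelian.Ext.{u} M V (n + 1))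

variable {K P M V : ModuleCat.{u} R} {f : K →ₗ[R] P} {g : P →ₗ[R] M}

lemma shortExact_of_exact (hf : Function.Injective f) (hfg : Function.Exact f g)
    (hg : Function.Surjective g) :
    (ModuleCat.shortComplexOfCompEqZero f g hfg.linearMap_comp_eq_zero).ShortExact :=
  ModuleCat.shortComplex_shortExact _ hfg hf hg

lemma ExtVanish.of_projective [Module.Projective R P] : ExtVanish P V := fun _ =>
  subsingleton_of_forall_eq 0 fun x => x.eq_zero_of_projective

lemma ExtVanish.ker (hf : Function.Injective f) (hfg : Function.Exact f g)
    (hg : Function.Surjective g) (hP : ExtVanish P V) (hM : ExtVanish M V) :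
    ExtVanish K V := fun n => by
  have hS := shortExact_of_exact hf hfg hg
  have := hP n
  have := hM (n + 1)
  refine subsingleton_of_forall_eq 0 fun x => ?_
  obtain ⟨y, rfl⟩ := Abelian.Ext.contravariant_sequence_exact₁ hS V x (n₁ := n + 1 + 1)
    (by lia) (Subsingleton.elim _ _)
  rw [Subsingleton.elim y 0, Abelian.Ext.comp_zero]

lemma lcomp_surjective_of_ext (hf : Function.Injective f) (hfg : Function.Exact f g)
    (hg : Function.Surjective g) (hM : ExtVanish M V) :
    Function.Surjective (f.lcomp R V) := fun h => by
  have hS := shortExact_of_exact hf hfg hg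
  have := hM 0
  obtain ⟨y, hy⟩ := Abelian.Ext.contravariant_sequence_exact₁ hS V
    (Abelian.Ext.mk₀ (ModuleCat.ofHom h)) (n₁ := 0 + 1) (by lia) (Subsingleton.elim _ _)
  obtain ⟨k, rfl⟩ := Abelian.Ext.addEquiv₀.symm.surjective y
  rw [Abelian.Ext.addEquiv₀_symm_apply, Abelian.Ext.mk₀_comp_mk₀] at hy
  exact ⟨k.hom, congrArg ModuleCat.Hom.hom ((Abelian.Ext.mk₀_bijective _ _).1 hy)⟩

/-- Dimension shifting along a family of short exact sequences. -/
lemma ext_subsingleton_of_step (S : ModuleCat.{u} R → Prop)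
    (hS : ∀ M, S M → ∃ (K P : ModuleCat.{u} R) (f : K →ₗ[R] P) (g : P →ₗ[R] M),
      Function.Injective f ∧ Function.Exact f g ∧ Function.Surjective g ∧ ExtVanish P V ∧ S K ∧
        Function.Surjective (f.lcomp R V)) (hM : S M) : ExtVanish M V := fun n => by
  induction n generalizing M with
  | zero =>
    obtain ⟨K, P, f, g, hf, hfg, hg, hP, hK, hs⟩ := hS M hM
    have hS := shortExact_of_exact hf hfg hg
    have := hP 0
    refine subsingleton_of_forall_eq 0 fun x => ?_
    obtain ⟨y, rfl⟩ := Abelian.Ext.contravariant_sequence_exact₃ hS V x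
      (Subsingleton.elim _ _) (n₀ := 0) (by lia)
    obtain ⟨k, rfl⟩ := Abelian.Ext.addEquiv₀.symm.surjective y
    obtain ⟨l, hl⟩ := hs k.hom
    have hk : k = ModuleCat.ofHom f ≫ ModuleCat.ofHom l := ModuleCat.hom_ext hl.symm
    rw [hk, Abelian.Ext.addEquiv₀_symm_apply, ← Abelian.Ext.mk₀_comp_mk₀]
    exact hS.extClass_comp_assoc _
  | succ n ih =>
    obtain ⟨K, P, f, g, hf, hfg, hg, hP, hK, hs⟩ := hS M hM
    have hS := shortExact_of_exact hf hfg hg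
    have := hP (n + 1)
    have := ih hK
    refine subsingleton_of_forall_eq 0 fun x => ?_
    obtain ⟨y, rfl⟩ := Abelian.Ext.contravariant_sequence_exact₃ hS V x
      (Subsingleton.elim _ _) (n₀ := n + 1) (by lia)
    rw [Subsingleton.elim y 0, Abelian.Ext.comp_zero]

lemma ExtVanish.of_extZero (h : extZero R M V) : ExtVanish M V := fun n => by
  let Q := projectiveResolution M
  have h0 := h (n + 1) (by lia)
  have h1 : Limits.IsZero ((Q.complex.linearYonedaObj R V).homology (n + 1)) :=
    Limits.IsZero.of_iso (ModuleCat.isZero_of_subsingleton _) (Q.isoExt (n + 1) V).symm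
  rw [← HomologicalComplex.exactAt_iff_isZero_homology,
    HomologicalComplex.exactAt_iff' _ n (n + 1) (n + 2) (by simp) (by simp),
    ShortComplex.ShortExact.moduleCat_exact_iff_function_exact] at h1
  refine subsingleton_of_forall_eq 0 fun x => ?_
  obtain ⟨φ, hφ, rfl⟩ := Q.extMk_surjective x (n + 2) rfl
  rw [Q.extMk_eq_zero_iff φ _ _ hφ n rfl]
  exact (h1 φ).1 hφ

end ExtVanishing

section TensorSteps

variable {R : Type u} [CommRing R] {C : ModuleCat.{u} R}

lemma ExtVanish.of_flat (P J : ModuleCat.{u} R) [Module.Flat R P] :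
    ExtVanish P (ModuleCat.of R (CharacterModule J)) := by
  refine ext_subsingleton_of_step (fun P => Module.Flat R P) (fun P hP => ?_) ‹_›
  have : Module.Flat R P := hP
  let p : (P →₀ R) →ₗ[R] P := Finsupp.linearCombination R id
  have hp : Function.Surjective p := Finsupp.linearCombination_id_surjective R P
  have hi := Submodule.injective_subtype (LinearMap.ker p)
  have hpure := rTensor_injective_of_flat (K := LinearMap.ker p) hi p.exact_subtype_ker_map hp J
  exact ⟨ModuleCat.of R (LinearMap.ker p), ModuleCat.of R (P →₀ R), (LinearMap.ker p).subtype, p,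
    hi, p.exact_subtype_ker_map, hp, ExtVanish.of_projective,
    flat_of_exact_of_flat hi p.exact_subtype_ker_map hp,
    rTensor_injective_iff_lcomp_surjective.1 hpure⟩

/-- Every member of `S` is the cokernel of a map from a member of `S` to a flat module which stays
injective after tensoring with `C`-injective modules. -/
def TensorStep (C : ModuleCat.{u} R) (S : ModuleCat.{u} R → Prop) : Prop :=
  ∀ M, S M → ∃ (K P : ModuleCat.{u} R) (f : K →ₗ[R] P) (g : P →ₗ[R] M),
    Function.Injective f ∧ Function.Exact f g ∧ Function.Surjective g ∧ Module.Flat R P ∧ S K ∧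
      ∀ I : ModuleCat.{u} R, Module.Injective R I → Function.Injective (f.rTensor (C →ₗ[R] I))

/-- `Ext^{≥ 1}(M, -)` vanishes on the character modules of `C`-injective modules. This encodes
`Tor_{≥ 1}(M, Hom(C, I)) = 0`. -/
def TorVanish (C M : ModuleCat.{u} R) : Prop :=
  ∀ I : ModuleCat.{u} R, Module.Injective R I →
    ExtVanish M (ModuleCat.of R (CharacterModule (C →ₗ[R] I)))

lemma TensorStep.torVanish {S : ModuleCat.{u} R → Prop} (hS : TensorStep C S)
    {M : ModuleCat.{u} R} (hM : S M) : TorVanish C M := fun I hI => by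
  refine ext_subsingleton_of_step S (fun M hM => ?_) hM
  obtain ⟨K, P, f, g, hf, hfg, hg, hP, hK, hJ⟩ := hS M hM
  exact ⟨K, P, f, g, hf, hfg, hg, ExtVanish.of_flat P (ModuleCat.of R (C →ₗ[R] I)), hK,
    rTensor_injective_iff_lcomp_surjective.1 (hJ I hI)⟩

lemma TorVanish.rTensor_injective {K P M : ModuleCat.{u} R} {f : K →ₗ[R] P} {g : P →ₗ[R] M}
    (hf : Function.Injective f) (hfg : Function.Exact f g) (hg : Function.Surjective g)
    (hM : TorVanish C M) (I : ModuleCat.{u} R) (hI : Module.Injective R I) :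
    Function.Injective (f.rTensor (C →ₗ[R] I)) :=
  rTensor_injective_iff_lcomp_surjective.2 (lcomp_surjective_of_ext hf hfg hg (hM I hI))

lemma rTensor_injective_of_lcomp_surjective {I N N' : Type u} {C : Type u} [AddCommGroup C]
    [Module R C] [AddCommGroup I] [Module R I]
    [Module.Injective R I] [AddCommGroup N] [Module R N] [Module.FinitePresentation R N]
    [AddCommGroup N'] [Module R N'] {f : N →ₗ[R] N'}
    (hf : Function.Surjective (f.lcomp R C)) : Function.Injective (f.rTensor (C →ₗ[R] I)) := by
  have hf' : Function.Injective ((f.lcomp R C).lcomp R I) :=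
    LinearMap.lcomp_injective_of_surjective _ hf
  have h := hf'.comp (tensorHomEval_bijective (C := C) (I := I) (N := N)).1
  rw [← LinearMap.coe_comp, ← tensorHomEval_naturality, LinearMap.coe_comp] at h
  exact h.of_comp

lemma rTensor_lTensor_injective {A B J F : Type*} [AddCommGroup A] [Module R A]
    [AddCommGroup B] [Module R B] [AddCommGroup J] [Module R J] [AddCommGroup F] [Module R F]
    [Module.Flat R F] {f : A →ₗ[R] B} (hf : Function.Injective (f.rTensor J)) :
    Function.Injective ((f.lTensor F).rTensor J) := by
  have h : (f.lTensor F).rTensor J = (TensorProduct.assoc R F B J).symm.toLinearMap ∘ₗ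
      (f.rTensor J).lTensor F ∘ₗ (TensorProduct.assoc R F A J).toLinearMap := by
    ext
    simp
  rw [h]
  exact (TensorProduct.assoc R F B J).symm.injective.comp
    ((Module.Flat.lTensor_preserves_injective_linearMap _ hf).comp
      (TensorProduct.assoc R F A J).injective)

/-- Modules `F ⊗ K` with `K` finitely generated and `Ext^{≥ 1}(K, C) = 0`. -/
def TensorFinite (C F X : ModuleCat.{u} R) : Prop :=
  ∃ K : ModuleCat.{u} R, Module.Finite R K ∧ ExtVanish K C ∧ Nonempty (X ≃ₗ[R] F ⊗[R] K)

lemma tensorStep_tensorFinite [IsNoetherianRing R] (F : ModuleCat.{u} R) [Module.Flat R F] :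
    TensorStep C (TensorFinite C F) := by
  rintro X ⟨K, hK, hKC, ⟨e⟩⟩
  obtain ⟨n, p, hp⟩ := Module.Finite.exists_fin' R K
  have hi := Submodule.injective_subtype (LinearMap.ker p)
  have hip := p.exact_subtype_ker_map
  refine ⟨ModuleCat.of R (F ⊗[R] LinearMap.ker p), ModuleCat.of R (F ⊗[R] (Fin n → R)),
    (LinearMap.ker p).subtype.lTensor F, e.symm.toLinearMap ∘ₗ p.lTensor F,
    Module.Flat.lTensor_preserves_injective_linearMap _ hi, ?_,
    e.symm.surjective.comp (LinearMap.lTensor_surjective F hp),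
    inferInstanceAs (Module.Flat R (F ⊗[R] (Fin n → R))),
    ⟨ModuleCat.of R (LinearMap.ker p), inferInstanceAs (Module.Finite R (LinearMap.ker p)),
      ExtVanish.ker (P := ModuleCat.of R (Fin n → R)) hi hip hp ExtVanish.of_projective hKC,
      ⟨LinearEquiv.refl R _⟩⟩, fun I hI => ?_⟩
  · exact (LinearEquiv.postcomp_exact_iff_exact).2 (lTensor_exact F hip hp)
  · have := Module.finitePresentation_of_finite R (LinearMap.ker p)
    exact rTensor_lTensor_injective (rTensor_injective_of_lcomp_surjective
      (lcomp_surjective_of_ext (K := ModuleCat.of R (LinearMap.ker p))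
        (P := ModuleCat.of R (Fin n → R)) hi hip hp hKC))

lemma IsCFlat.exists_tensorStep [IsNoetherianRing R] (hC : IsSemidualizing R C)
    {M : ModuleCat.{u} R} (hM : IsCFlat R C M) : ∃ S, TensorStep C S ∧ S M := by
  obtain ⟨F, hF, he⟩ := hM
  exact ⟨_, tensorStep_tensorFinite F, C, hC.1, ExtVanish.of_extZero hC.2.2, he⟩

lemma injective_of_exact_comp {A B D E : Type*} [AddCommGroup A] [AddCommGroup B]
    [AddCommGroup D] [AddCommGroup E] [Module R A] [Module R B] [Module R D] [Module R E]
    {a : A →ₗ[R] B} {q : B →ₗ[R] D} {f : D →ₗ[R] E} (hq : Function.Surjective q)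
    (hqa : q ∘ₗ a = 0) (h : Function.Exact a (f ∘ₗ q)) : Function.Injective f := by
  rw [injective_iff_map_eq_zero]
  intro x hx
  obtain ⟨y, rfl⟩ := hq x
  obtain ⟨z, rfl⟩ := (h y).1 hx
  exact LinearMap.congr_fun hqa z

lemma IsGCFlat.torVanish {M : ModuleCat.{u} R} (hM : IsGCFlat R C M) : TorVanish C M := by
  obtain ⟨Z, hZ, hflat, -, hten, hcok⟩ := hM
  let S : ModuleCat.{u} R → Prop := fun N =>
    ∃ i : ℤ, 0 ≤ i ∧ Nonempty (N ≃ₗ[R] (Z.X i ⧸ LinearMap.range (Z.d i)))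
  refine TensorStep.torVanish (S := S) ?_ ⟨0, le_rfl, hcok⟩
  rintro N ⟨i, hi, ⟨e⟩⟩
  let q := (LinearMap.range (Z.d (i + 1))).mkQ
  let f : (Z.X (i + 1) ⧸ LinearMap.range (Z.d (i + 1))) →ₗ[R] Z.X i :=
    (LinearMap.range (Z.d (i + 1))).liftQ (Z.d i)
      (LinearMap.range_le_ker_iff.2 (Z.d_comp_d i))
  have hq : Function.Surjective q := Submodule.mkQ_surjective _
  have hfq : f ∘ₗ q = Z.d i := Submodule.liftQ_mkQ _ _ _
  have hqd : q ∘ₗ Z.d (i + 1) = 0 := LinearMap.range_mkQ_comp _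
  refine ⟨ModuleCat.of R (Z.X (i + 1) ⧸ LinearMap.range (Z.d (i + 1))), Z.X i, f,
    e.symm.toLinearMap ∘ₗ (LinearMap.range (Z.d i)).mkQ,
    injective_of_exact_comp hq hqd (hfq ▸ hZ i), ?_,
    e.symm.surjective.comp (Submodule.mkQ_surjective _), hflat i hi,
    ⟨i + 1, by lia, ⟨LinearEquiv.refl R _⟩⟩, fun I hI => ?_⟩
  · refine (LinearEquiv.postcomp_exact_iff_exact).2 ?_
    have := (Z.d i).exact_map_mkQ_range
    rw [← hfq] at this ⊢
    exact (Function.Surjective.comp_exact_iff_exact hq).1 this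
  · refine injective_of_exact_comp (LinearMap.rTensor_surjective _ hq)
      (a := (Z.d (i + 1)).rTensor (C →ₗ[R] I)) ?_ ?_
    · rw [← LinearMap.rTensor_comp, hqd, LinearMap.rTensor_zero]
    · rw [← LinearMap.rTensor_comp, hfq]
      exact hten (ModuleCat.of R (C →ₗ[R] I)) ⟨I, hI, ⟨LinearEquiv.refl R _⟩⟩ i

end TensorSteps

section Resolutions

variable {R : Type u} [CommRing R] {C : ModuleCat.{u} R}

lemma IsCFlat.of_linearEquiv {M N : ModuleCat.{u} R} (e : M ≃ₗ[R] N) (hM : IsCFlat R C M) :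
    IsCFlat R C N := by
  obtain ⟨F, hF, ⟨e'⟩⟩ := hM
  exact ⟨F, hF, ⟨e.symm ≪≫ₗ e'⟩⟩

lemma IsCFlat.of_exact [IsNoetherianRing R] (hC : IsSemidualizing R C)
    {K P M : ModuleCat.{u} R} {f : K →ₗ[R] P} {g : P →ₗ[R] M} (hf : Function.Injective f)
    (hfg : Function.Exact f g) (hg : Function.Surjective g) (hK : IsCFlat R C K)
    (hP : IsCFlat R C P) (hM : TorVanish C M) : IsCFlat R C M := by
  obtain ⟨F₁, h₁, ⟨e₁⟩⟩ := hK
  obtain ⟨F₀, h₀, ⟨e₀⟩⟩ := hP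
  have := hC.1
  have := Module.finitePresentation_of_finite R C
  let f' : F₁ ⊗[R] C →ₗ[R] F₀ ⊗[R] C := e₀.toLinearMap ∘ₗ f ∘ₗ e₁.symm.toLinearMap
  let g' : F₀ ⊗[R] C →ₗ[R] M := g ∘ₗ e₀.symm.toLinearMap
  have hf' : Function.Injective f' := e₀.injective.comp (hf.comp e₁.symm.injective)
  have hg' : Function.Surjective g' := hg.comp e₀.symm.surjective
  have hfg' : Function.Exact f' g' := by
    refine LinearEquiv.conj_exact_iff_exact _ _ e₀ |>.2 ?_
    exact LinearEquiv.precomp_exact_iff_exact.2 hfg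
  exact exists_flat_of_rTensor_injective hC.2.1 hfg' hg' fun I _ _ hI =>
    hM.rTensor_injective (K := ModuleCat.of R (F₁ ⊗[R] C)) (P := ModuleCat.of R (F₀ ⊗[R] C))
      hf' hfg' hg' (ModuleCat.of R I) hI

lemma TorVanish.isCFlat_of_hasResOfLength [IsNoetherianRing R] (hC : IsSemidualizing R C)
    {n : ℕ} {M : ModuleCat.{u} R} (hM : TorVanish C M)
    (h : HasResOfLength R (IsCFlat R C) n M) : IsCFlat R C M := by
  induction n generalizing M with
  | zero =>
    obtain ⟨P, d, ε, hε, hdε, -, hP, h0⟩ := h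
    have := h0 1 (by lia)
    have hinj : Function.Injective ε := by
      rw [injective_iff_map_eq_zero]
      intro x hx
      obtain ⟨y, rfl⟩ := (hdε x).1 hx
      rw [Subsingleton.elim y 0, map_zero]
    exact (hP 0 le_rfl).of_linearEquiv (LinearEquiv.ofBijective ε ⟨hinj, hε⟩)
  | succ n ih =>
    obtain ⟨P, d, ε, hε, hdε, hd, hP, h0⟩ := h
    let K : ModuleCat.{u} R := ModuleCat.of R (LinearMap.ker ε)
    let ι : K →ₗ[R] P 0 := (LinearMap.ker ε).subtype
    have hι : Function.Injective ι := Submodule.injective_subtype _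
    have hιε : Function.Exact ι ε := ε.exact_subtype_ker_map
    let ε' : P 1 →ₗ[R] K := (d 0).codRestrict (LinearMap.ker ε) hdε.apply_apply_eq_zero
    have hε' : ι ∘ₗ ε' = d 0 := LinearMap.subtype_comp_codRestrict _ _ _
    obtain ⟨S, hS, hSP⟩ := (hP 0 (Nat.zero_le _)).exists_tensorStep hC
    have hKtor : TorVanish C K := fun I hI =>
      ExtVanish.ker hι hιε hε (hS.torVanish hSP I hI) (hM I hI)
    have hK : HasResOfLength R (IsCFlat R C) n K := by
      refine ⟨fun i => P (i + 1), fun i => d (i + 1), ε', fun x => ?_, ?_, fun i => hd (i + 1),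
        fun i hi => hP (i + 1) (by lia), fun i hi => h0 (i + 1) (by lia)⟩
      · obtain ⟨y, hy⟩ := (hdε (ι x)).1 x.2
        exact ⟨y, hι hy⟩
      · exact (Function.Injective.comp_exact_iff_exact hι).1 (hε' ▸ hd 0)
    exact IsCFlat.of_exact hC hι hιε hε (ih hKtor hK) (hP 0 (Nat.zero_le _)) hM

lemma IsCFlat.hasResOfLength_zero {M : ModuleCat.{u} R} (hM : IsCFlat R C M) :
    HasResOfLength R (IsCFlat R C) 0 M := by
  refine ⟨fun i => Nat.casesOn i M fun _ => ModuleCat.of R PUnit, fun i => 0, LinearMap.id,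
    Function.surjective_id, ?_, fun i x => ?_, fun i hi => ?_, fun i hi => ?_⟩
  · intro x
    simp [eq_comm]
  · exact iff_of_true rfl ⟨0, rfl⟩
  · obtain rfl : i = 0 := by lia
    exact hM
  · cases i with
    | zero => exact absurd hi (lt_irrefl _)
    | succ i => exact inferInstanceAs (Subsingleton PUnit.{u + 1})

lemma isCFlat_punit : IsCFlat R C (ModuleCat.of R PUnit.{u + 1}) :=
  ⟨ModuleCat.of R PUnit, inferInstanceAs (Module.Flat R PUnit.{u + 1}),
    ⟨{ (0 : PUnit.{u + 1} →ₗ[R] PUnit.{u + 1} ⊗[R] C) with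
        invFun := 0
        left_inv := fun _ => rfl
        right_inv := fun _ => Subsingleton.elim _ _ }⟩⟩

lemma TensorStep.exists_seq {S : ModuleCat.{u} R → Prop} (hS : TensorStep C S)
    {M : ModuleCat.{u} R} (hM : S M) :
    ∃ (K P : ℕ → ModuleCat.{u} R) (f : ∀ n, K (n + 1) →ₗ[R] P n) (g : ∀ n, P n →ₗ[R] K n),
      Nonempty (M ≃ₗ[R] K 0) ∧ (∀ n, Function.Injective (f n)) ∧
      (∀ n, Function.Exact (f n) (g n)) ∧ (∀ n, Function.Surjective (g n)) ∧
      (∀ n, Module.Flat R (P n)) ∧ ∀ n, ∀ I : ModuleCat.{u} R, Module.Injective R I →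
        Function.Injective ((f n).rTensor (C →ₗ[R] I)) := by
  choose K P f g hf hfg hg hP hK hJ using fun N : {N // S N} => hS N N.2
  let next : ℕ → {N // S N} := fun n => Nat.rec ⟨M, hM⟩ (fun _ N => ⟨K N, hK N⟩) n
  exact ⟨fun n => (next n).1, fun n => P (next n), fun n => f (next n), fun n => g (next n),
    ⟨LinearEquiv.refl R M⟩, fun n => hf _, fun n => hfg _, fun n => hg _, fun n => hP _,
    fun n => hJ _⟩

lemma exact_splice {A B D E F : Type*} [AddCommGroup A] [AddCommGroup B] [AddCommGroup D]
    [AddCommGroup E] [AddCommGroup F] [Module R A] [Module R B] [Module R D] [Module R E]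
    [Module R F] {p : A →ₗ[R] B} {i : B →ₗ[R] D} {q : D →ₗ[R] E} {j : E →ₗ[R] F}
    (hp : Function.Surjective p) (hiq : Function.Exact i q) (hj : Function.Injective j) :
    Function.Exact (i ∘ₗ p) (j ∘ₗ q) :=
  (Function.Injective.comp_exact_iff_exact hj).2
    ((Function.Surjective.comp_exact_iff_exact hp).2 hiq)

lemma exact_zero_of_surjective {A B D : Type*} [AddCommGroup A] [AddCommGroup B] [AddCommGroup D]
    [Module R A] [Module R B] [Module R D] {p : A →ₗ[R] B} (hp : Function.Surjective p) :
    Function.Exact p (0 : B →ₗ[R] D) :=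
  fun b => iff_of_true rfl (hp b)

section Splice

variable {K P : ℕ → ModuleCat.{u} R} (f : ∀ n, K (n + 1) →ₗ[R] P n) (g : ∀ n, P n →ₗ[R] K n)

/-- The modules of the complex `⋯ → P 1 → P 0 → K 0 → 0 → ⋯`. -/
def spliceX (K P : ℕ → ModuleCat.{u} R) : ℤ → ModuleCat.{u} R
  | .ofNat n => P n
  | .negSucc 0 => K 0
  | .negSucc (_ + 1) => ModuleCat.of R PUnit

/-- The differentials of the complex `⋯ → P 1 → P 0 → K 0 → 0 → ⋯`. -/
def spliceD : ∀ i : ℤ, spliceX K P (i + 1) →ₗ[R] spliceX K P i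
  | .ofNat n => (f n ∘ₗ g (n + 1) : P (n + 1) →ₗ[R] P n)
  | .negSucc 0 => (g 0 : P 0 →ₗ[R] K 0)
  | .negSucc (_ + 1) => 0

lemma spliceD_exact (hf : ∀ n, Function.Injective (f n)) (hfg : ∀ n, Function.Exact (f n) (g n))
    (hg : ∀ n, Function.Surjective (g n)) (i : ℤ) :
    Function.Exact (spliceD f g (i + 1)) (spliceD f g i) := by
  match i with
  | .ofNat n => exact exact_splice (hg (n + 2)) (hfg (n + 1)) (hf n)
  | .negSucc 0 =>
    change Function.Exact (f 0 ∘ₗ g 1) (g 0)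
    exact (Function.Surjective.comp_exact_iff_exact (hg 1)).2 (hfg 0)
  | .negSucc 1 => exact exact_zero_of_surjective (hg 0)
  | .negSucc (n + 2) => exact exact_zero_of_surjective fun (x : PUnit.{u + 1}) => ⟨0, rfl⟩

lemma spliceD_rTensor_exact (hfg : ∀ n, Function.Exact (f n) (g n))
    (hg : ∀ n, Function.Surjective (g n)) (J : ModuleCat.{u} R)
    (hJ : ∀ n, Function.Injective ((f n).rTensor J)) (i : ℤ) :
    Function.Exact ((spliceD f g (i + 1)).rTensor J) ((spliceD f g i).rTensor J) := by
  match i with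
  | .ofNat n =>
    change Function.Exact ((f (n + 1) ∘ₗ g (n + 2)).rTensor J) ((f n ∘ₗ g (n + 1)).rTensor J)
    rw [LinearMap.rTensor_comp, LinearMap.rTensor_comp]
    exact exact_splice (LinearMap.rTensor_surjective _ (hg (n + 2)))
      (rTensor_exact J (hfg (n + 1)) (hg (n + 1))) (hJ n)
  | .negSucc 0 =>
    change Function.Exact ((f 0 ∘ₗ g 1).rTensor J) ((g 0).rTensor J)
    rw [LinearMap.rTensor_comp]
    exact (Function.Surjective.comp_exact_iff_exact (LinearMap.rTensor_surjective _ (hg 1))).2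
      (rTensor_exact J (hfg 0) (hg 0))
  | .negSucc 1 =>
    exact rTensor_exact J (exact_zero_of_surjective (hg 0)) fun (x : PUnit.{u + 1}) => ⟨0, rfl⟩
  | .negSucc (n + 2) =>
    exact rTensor_exact J (exact_zero_of_surjective fun (x : PUnit.{u + 1}) => ⟨0, rfl⟩)
      fun (x : PUnit.{u + 1}) => ⟨0, rfl⟩

end Splice

lemma TensorStep.isGCFlat {S : ModuleCat.{u} R → Prop} (hS : TensorStep C S)
    {M : ModuleCat.{u} R} (hSM : S M) (hM : IsCFlat R C M) : IsGCFlat R C M := by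
  obtain ⟨K, P, f, g, ⟨e⟩, hf, hfg, hg, hP, hJ⟩ := hS.exists_seq hSM
  have hex := spliceD_exact f g hf hfg hg
  refine ⟨⟨spliceX K P, spliceD f g, fun i => (hex i).linearMap_comp_eq_zero⟩, hex, ?_, ?_, ?_, ?_⟩
  · intro i hi
    match i with
    | .ofNat n => exact hP n
    | .negSucc n => exact absurd hi (by lia)
  · intro i hi
    match i with
    | .ofNat n => exact absurd hi (by lia)
    | .negSucc 0 => exact hM.of_linearEquiv e
    | .negSucc (n + 1) => exact isCFlat_punit
  · rintro J ⟨I, hI, ⟨e⟩⟩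
    exact spliceD_rTensor_exact f g hfg hg J fun n =>
      rTensor_injective_congr (f n) e.symm (hJ n I hI)
  · exact ⟨e ≪≫ₗ ((hex (Int.negSucc 0)).linearEquivOfSurjective (hg 0)).symm⟩

end Resolutions

/-- `M` is `C`-flat iff `M` is `G_C`-flat and has finite `C`-flat
projective dimension. -/
theorem stmt18 (R : Type u) [CommRing R] [IsNoetherianRing R]
    (C : ModuleCat.{u} R) (hC : IsSemidualizing R C) (M : ModuleCat.{u} R) :
    IsCFlat R C M ↔
      (IsGCFlat R C M ∧ ∃ n, HasResOfLength R (IsCFlat R C) n M) := by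
  refine ⟨fun h => ?_, fun ⟨h, n, hn⟩ => h.torVanish.isCFlat_of_hasResOfLength hC hn⟩
  obtain ⟨S, hS, hSM⟩ := h.exists_tensorStep hC
  exact ⟨hS.isGCFlat hSM h, 0, h.hasResOfLength_zero⟩
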